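/- Let (𝒰, ρ) and (𝒱, ρ_𝒱) be complete metric spaces, 𝓕 : 𝒰 → 𝒱 continuous, and f ∈ W(ℝ, 𝒰) equi-Weyl almost periodic (with respect to the truncated metric). Then 𝓕 ∘ f ∈ W(ℝ, 𝒱). -/

import Mathlib

open MeasureTheory

/-- A set `T ⊆ ℝ` is relatively dense. -/
def RelDense (T : Set ℝ) : Prop :=
  ∃ a > (0 : ℝ), ∀ ξ : ℝ, ∃ τ ∈ T, ξ ≤ τ ∧ τ ≤ ξ + a

/-- `f ∈ W(ℝ,𝒰)`: equi-Weyl a.p. w.r.t. the truncated metric `min 1 ρ`. -/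
def WAP {U : Type*} [MetricSpace U] (f : ℝ → U) : Prop :=
  AEStronglyMeasurable f volume ∧
    ∀ ε > (0 : ℝ), ∃ l > (0 : ℝ), RelDense {τ : ℝ |
      (⨆ ξ : ℝ, (1 / l) * ∫ t in ξ..(ξ + l), min 1 (dist (f t) (f (t + τ)))) < ε}

namespace WAPProof

open Set Filter Topology

lemma aesm_D {U : Type*} [MetricSpace U] {f : ℝ → U} (hf : AEStronglyMeasurable f volume)
    (τ : ℝ) : AEStronglyMeasurable (fun t => min 1 (dist (f t) (f (t + τ)))) volume := by
  have h2 : AEStronglyMeasurable (fun t => f (t + τ)) volume :=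
    hf.comp_measurePreserving (measurePreserving_add_right volume τ)
  have h3 : AEStronglyMeasurable (fun t => dist (f t) (f (t + τ))) volume := hf.dist h2
  exact (aestronglyMeasurable_const (b := (1:ℝ))).inf h3

lemma int_D {h : ℝ → ℝ} (hm : AEStronglyMeasurable h volume) (h0 : ∀ t, 0 ≤ h t)
    (h1 : ∀ t, h t ≤ 1) (a b : ℝ) : IntegrableOn h (Ioc a b) volume := by
  refine Measure.integrableOn_of_bounded (M := 1) (by simp) hm ?_
  exact Eventually.of_forall fun t => by rw [Real.norm_of_nonneg (h0 t)]; exact h1 t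

lemma eq_lint {h : ℝ → ℝ} (hm : AEStronglyMeasurable h volume) (h0 : ∀ t, 0 ≤ h t)
    (h1 : ∀ t, h t ≤ 1) (a l : ℝ) (hl : 0 < l) :
    ENNReal.ofReal (∫ t in a..(a + l), h t) = ∫⁻ t in Ioc a (a + l), ENNReal.ofReal (h t) := by
  rw [intervalIntegral.integral_of_le (by linarith)]
  exact ofReal_integral_eq_lintegral_ofReal (int_D hm h0 h1 _ _) (Eventually.of_forall h0)

lemma sup_to {h : ℝ → ℝ} (hm : AEStronglyMeasurable h volume) (h0 : ∀ t, 0 ≤ h t)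
    (h1 : ∀ t, h t ≤ 1) {l c : ℝ} (hl : 0 < l)
    (hs : (⨆ ξ : ℝ, (1 / l) * ∫ t in ξ..(ξ + l), h t) < c) (ξ : ℝ) :
    ∫⁻ t in Ioc ξ (ξ + l), ENNReal.ofReal (h t) ≤ ENNReal.ofReal (c * l) := by
  rw [← eq_lint hm h0 h1 _ _ hl]
  apply ENNReal.ofReal_le_ofReal
  have hb : BddAbove (range fun ξ : ℝ => (1 / l) * ∫ t in ξ..(ξ + l), h t) := by
    refine ⟨1, ?_⟩
    rintro _ ⟨x, rfl⟩
    have h2 : ∫ t in x..(x + l), h t ≤ ∫ t in x..(x + l), (1:ℝ) := by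
      refine intervalIntegral.integral_mono_on (by linarith) ?_ (by simp) (fun t _ => h1 t)
      rw [intervalIntegrable_iff_integrableOn_Ioc_of_le (by linarith)]
      exact int_D hm h0 h1 _ _
    simp at h2
    show 1 / l * ∫ t in x..(x + l), h t ≤ 1
    rw [one_div, inv_mul_le_iff₀ hl]
    linarith
  have h3 := (le_ciSup hb ξ).trans hs.le
  rw [one_div, inv_mul_le_iff₀ hl] at h3
  linarith

lemma to_sup {h : ℝ → ℝ} (hm : AEStronglyMeasurable h volume) (h0 : ∀ t, 0 ≤ h t)
    (h1 : ∀ t, h t ≤ 1) {l c : ℝ} (hl : 0 < l) (hc : 0 ≤ c)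
    (hs : ∀ ξ, ∫⁻ t in Ioc ξ (ξ + l), ENNReal.ofReal (h t) ≤ ENNReal.ofReal (c * l)) :
    (⨆ ξ : ℝ, (1 / l) * ∫ t in ξ..(ξ + l), h t) ≤ c := by
  refine ciSup_le fun ξ => ?_
  have h2 := hs ξ
  rw [← eq_lint hm h0 h1 _ _ hl, ENNReal.ofReal_le_ofReal_iff (by positivity)] at h2
  rw [one_div, inv_mul_le_iff₀ hl]
  linarith

lemma chain (ν : Measure ℝ) {l c : ℝ} (hl : 0 < l) (hc : 0 ≤ c)
    (h : ∀ ξ, ν (Ioc ξ (ξ + l)) ≤ ENNReal.ofReal (c * l)) (k : ℕ) (ξ : ℝ) :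
    ν (Ioc ξ (ξ + k * l)) ≤ ENNReal.ofReal (c * (k * l)) := by
  induction k with
  | zero => simp
  | succ k ih =>
    have : Ioc ξ (ξ + (k + 1 : ℕ) * l) ⊆ Ioc ξ (ξ + k * l) ∪ Ioc (ξ + k * l) (ξ + k * l + l) := by
      intro t ht
      push_cast at ht
      rcases le_or_gt t (ξ + k * l) with h' | h'
      · exact Or.inl ⟨ht.1, h'⟩
      · exact Or.inr ⟨h', by linarith [ht.2]⟩
    calc _ ≤ _ := measure_mono this
      _ ≤ _ := measure_union_le _ _
      _ ≤ ENNReal.ofReal (c * (k * l)) + ENNReal.ofReal (c * l) := add_le_add ih (h _)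
      _ = _ := by
        rw [← ENNReal.ofReal_add (by positivity) (by positivity)]
        congr 1; push_cast; ring

lemma markov {h : ℝ → ℝ} (hm : AEStronglyMeasurable h volume) {s : Set ℝ} {δ c : ℝ} (hδ : 0 < δ)
    (hc : ∫⁻ t in s, ENNReal.ofReal (h t) ≤ ENNReal.ofReal (c * δ)) :
    volume ({t | δ ≤ h t} ∩ s) ≤ ENNReal.ofReal c := by
  have h1 := mul_meas_ge_le_lintegral₀ (μ := volume.restrict s)
    (f := fun t => ENNReal.ofReal (h t)) hm.restrict.aemeasurable.ennreal_ofReal (ENNReal.ofReal δ)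
  have h2 : volume ({t | δ ≤ h t} ∩ s) ≤ volume.restrict s {t | ENNReal.ofReal δ ≤ ENNReal.ofReal (h t)} := by
    refine le_trans (Measure.le_restrict_apply _ _) (measure_mono ?_)
    intro t ht
    exact ENNReal.ofReal_le_ofReal ht
  have h3 : ENNReal.ofReal δ * volume ({t | δ ≤ h t} ∩ s) ≤ ENNReal.ofReal δ * ENNReal.ofReal c := by
    refine (mul_le_mul_right h2 _).trans (h1.trans (hc.trans ?_))
    rw [← ENNReal.ofReal_mul hδ.le, mul_comm]
  exact (ENNReal.mul_le_mul_iff_right (by simpa using hδ) (by simp)).1 h3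

lemma base {U : Type*} [MetricSpace U] {f : ℝ → U} (hf : AEStronglyMeasurable f volume)
    (R η c : ℝ) (hη : 0 < η) (hc : 0 < c) :
    ∃ S : Finset U, volume ({t | ∀ s ∈ S, η ≤ dist (f t) s} ∩ Ioc 0 R) ≤ ENNReal.ofReal c := by
  classical
  have : Nonempty U := ⟨f 0⟩
  obtain ⟨T, hT, hfT⟩ := hf.isSeparable_ae_range
  obtain ⟨C, hC, hTC⟩ := hT
  have hCne : (insert (f 0) C).Nonempty := ⟨_, mem_insert _ _⟩
  obtain ⟨x, hx⟩ := (hC.insert (f 0)).exists_eq_range hCne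
  set A : ℕ → Set ℝ := fun n => {t | ∀ i < n, η ≤ dist (f t) (x i)} with hA
  have hAm : ∀ n, NullMeasurableSet (A n) (volume.restrict (Ioc 0 R)) := by
    intro n
    have : A n = ⋂ i, ⋂ (_ : i < n), {t | η ≤ dist (f t) (x i)} := by
      ext t; simp [hA]
    rw [this]
    refine NullMeasurableSet.iInter fun i => NullMeasurableSet.iInter fun _ => ?_
    exact nullMeasurableSet_le aemeasurable_const
      ((hf.dist aestronglyMeasurable_const).restrict.aemeasurable)
  have hanti : Antitone A := fun m n hmn t ht i hi => ht i (hi.trans_le hmn)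
  have hlim := tendsto_measure_iInter_atTop (μ := volume.restrict (Ioc 0 R)) hAm hanti
    ⟨0, by
      refine ne_of_lt (lt_of_le_of_lt (measure_mono (subset_univ _)) ?_)
      simp⟩
  have hz : volume.restrict (Ioc 0 R) (⋂ n, A n) = 0 := by
    have h1 : ∀ᵐ t ∂(volume.restrict (Ioc 0 R)), t ∉ ⋂ n, A n := by
      refine ae_restrict_of_ae ?_
      filter_upwards [hfT] with t ht hmem
      obtain ⟨b, hb, hd⟩ := Metric.mem_closure_iff.1 (hTC ht) η hη
      have : b ∈ range x := by rw [← hx]; exact mem_insert_of_mem _ hb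
      obtain ⟨i, rfl⟩ := this
      have := mem_iInter.1 hmem (i+1) i (Nat.lt_succ_self i)
      linarith
    exact measure_eq_zero_iff_ae_notMem.2 h1
  rw [hz] at hlim
  have hpos : (0 : ENNReal) < ENNReal.ofReal c := by simpa using hc
  obtain ⟨n, hn⟩ := (hlim.eventually (gt_mem_nhds hpos)).exists
  refine ⟨(Finset.range n).image x, le_trans (le_trans (measure_mono ?_) (Measure.le_restrict_apply _ (A n))) hn.le⟩
  rintro t ⟨h1, h2⟩
  exact ⟨fun i hi => h1 _ (Finset.mem_image_of_mem _ (Finset.mem_range.2 hi)), h2⟩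

/-- uniformly small upper density -/
def UD (B : Set ℝ) (c : ℝ) : Prop :=
  ∃ l0 > (0:ℝ), ∀ l ≥ l0, ∀ ξ, volume (B ∩ Ioc ξ (ξ + l)) ≤ ENNReal.ofReal (c * l)

lemma ud_of_window {B : Set ℝ} {c l0 : ℝ} (hc : 0 ≤ c) (hl0 : 0 < l0)
    (h : ∀ ξ, volume (B ∩ Ioc ξ (ξ + l0)) ≤ ENNReal.ofReal (c * l0)) : UD B (2 * c) := by
  refine ⟨l0, hl0, fun l hl ξ => ?_⟩
  have h1 := chain (volume.restrict B) hl0 hc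
    (fun ξ => by rw [Measure.restrict_apply measurableSet_Ioc, inter_comm]; exact h ξ)
    ⌈l / l0⌉₊ ξ
  rw [Measure.restrict_apply measurableSet_Ioc, inter_comm] at h1
  have hk1 : l ≤ ⌈l / l0⌉₊ * l0 := by
    rw [← div_le_iff₀ hl0]; exact Nat.le_ceil _
  have hk2 : ⌈l / l0⌉₊ * l0 ≤ 2 * l := by
    have h2 := Nat.ceil_lt_add_one (a := l / l0) (div_nonneg (by linarith) hl0.le)
    have h3 := mul_le_mul_of_nonneg_right h2.le hl0.le
    rw [add_mul, div_mul_cancel₀ _ hl0.ne'] at h3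
    linarith
  refine le_trans (measure_mono ?_) (h1.trans (ENNReal.ofReal_le_ofReal ?_))
  · exact inter_subset_inter_right _ (Ioc_subset_Ioc_right (by linarith))
  · nlinarith

lemma ud_union {B C : Set ℝ} {b c : ℝ} (hb : 0 ≤ b) (hc : 0 ≤ c) (h1 : UD B b) (h2 : UD C c) :
    UD (B ∪ C) (b + c) := by
  obtain ⟨l1, hl1, h1⟩ := h1
  obtain ⟨l2, hl2, h2⟩ := h2
  refine ⟨max l1 l2, lt_max_of_lt_left hl1, fun l hl ξ => ?_⟩
  have hl' : 0 ≤ l := (hl1.le.trans (le_max_left _ _)).trans hl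
  rw [union_inter_distrib_right, add_mul, ENNReal.ofReal_add (by positivity) (by positivity)]
  exact (measure_union_le _ _).trans (add_le_add (h1 l ((le_max_left _ _).trans hl) ξ)
    (h2 l ((le_max_right _ _).trans hl) ξ))

lemma ud_mono {B C : Set ℝ} {c d : ℝ} (hBC : B ⊆ C) (hcd : c ≤ d) (h : UD C c) : UD B d := by
  obtain ⟨l1, hl1, h1⟩ := h
  refine ⟨l1, hl1, fun l hl ξ => ?_⟩
  refine (measure_mono (inter_subset_inter_left _ hBC)).trans ((h1 l hl ξ).trans
    (ENNReal.ofReal_le_ofReal ?_))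
  have : 0 < l := hl1.trans_le hl
  gcongr

lemma D_nonneg {U : Type*} [MetricSpace U] (f : ℝ → U) (τ t : ℝ) :
    0 ≤ min 1 (dist (f t) (f (t + τ))) := le_min zero_le_one dist_nonneg

lemma totbdd' {U : Type*} [MetricSpace U] {f : ℝ → U} (hf : WAP f) {η : ℝ} (hη : 0 < η)
    (hη1 : η ≤ 1) : ∃ S : Finset U, UD {t | ∀ s ∈ S, 2 * η ≤ dist (f t) s} (4 * η) := by
  obtain ⟨hm, hf⟩ := hf
  obtain ⟨l, hl, a, ha, hT⟩ := hf (η * η) (by positivity)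
  obtain ⟨S, hS⟩ := base hm (a + l) η (η * l) hη (by positivity)
  refine ⟨S, ?_⟩
  have : 4 * η = 2 * (2 * η) := by ring
  rw [this]
  refine ud_of_window (by positivity) hl fun ξ => ?_
  obtain ⟨τ, hτ, h1, h2⟩ := hT (-ξ)
  have h3 := sup_to (aesm_D hm τ) (D_nonneg f τ) (fun t => min_le_left _ _) hl hτ ξ
  have h4 := markov (aesm_D hm τ) (c := η * l) hη (h3.trans (ENNReal.ofReal_le_ofReal (by linarith)))
  have h5 : volume ((fun t => t + τ) ⁻¹' ({t | ∀ s ∈ S, η ≤ dist (f t) s} ∩ Ioc 0 (a + l)))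
      ≤ ENNReal.ofReal (η * l) := by
    rw [measure_preimage_add_right]; exact hS
  have h6 : {t | ∀ s ∈ S, 2 * η ≤ dist (f t) s} ∩ Ioc ξ (ξ + l) ⊆
      ({t | η ≤ min 1 (dist (f t) (f (t + τ)))} ∩ Ioc ξ (ξ + l)) ∪
      ((fun t => t + τ) ⁻¹' ({t | ∀ s ∈ S, η ≤ dist (f t) s} ∩ Ioc 0 (a + l))) := by
    rintro t ⟨ht, ht2⟩
    by_cases hd : η ≤ dist (f t) (f (t + τ))
    · exact Or.inl ⟨le_min hη1 hd, ht2⟩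
    · refine Or.inr ⟨fun s hs => ?_, ?_, ?_⟩
      · have := ht s hs
        have := dist_triangle (f t) (f (t + τ)) s
        push Not at hd
        simp only
        linarith
      · linarith [ht2.1]
      · linarith [ht2.2]
  refine (measure_mono h6).trans ((measure_union_le _ _).trans ((add_le_add h4 h5).trans ?_))
  rw [← ENNReal.ofReal_add (by positivity) (by positivity)]
  exact ENNReal.ofReal_le_ofReal (by linarith)

lemma totbdd {U : Type*} [MetricSpace U] {f : ℝ → U} (hf : WAP f) {η : ℝ} (hη : 0 < η) :
    ∃ S : Finset U, UD {t | ∀ s ∈ S, η ≤ dist (f t) s} η := by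
  obtain ⟨S, hS⟩ := totbdd' hf (η := min 1 (η / 4)) (by positivity) (min_le_left _ _)
  have h1 : min 1 (η / 4) ≤ η / 4 := min_le_right _ _
  refine ⟨S, ud_mono ?_ (by linarith) hS⟩
  intro t ht s hs
  have := ht s hs
  linarith

lemma osc {U V : Type*} [MetricSpace U] [CompleteSpace U] [MetricSpace V]
    {F : U → V} (hF : Continuous F) {f : ℝ → U} (hf : WAP f) {ε : ℝ} (hε : 0 < ε) :
    ∃ δ > 0, δ ≤ 1 ∧ UD {t | ∃ y, dist (f t) y < δ ∧ ε ≤ dist (F (f t)) (F y)} ε := by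
  have hη : ∀ n : ℕ, 0 < ε * (1 / 2) ^ (n + 1) := fun n => by positivity
  choose S hS using fun n => totbdd hf (hη n)
  have key : ∃ N : ℕ, ∀ x y, (∀ n < N, ∃ s ∈ S n, dist x s < ε * (1 / 2) ^ (n + 1)) →
      dist x y < 1 / ((N:ℝ) + 1) → dist (F x) (F y) < ε := by
    by_contra! hcon
    choose x y hx hxy hFxy using hcon
    have htb : TotallyBounded (range x) := by
      rw [Metric.totallyBounded_iff]
      intro r hr
      have ht : Tendsto (fun n : ℕ => ε * (1 / 2 : ℝ) ^ (n + 1)) atTop (𝓝 (ε * 0)) :=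
        ((tendsto_pow_atTop_nhds_zero_of_lt_one (by norm_num) (by norm_num)).comp
          (tendsto_add_atTop_nat 1)).const_mul ε
      rw [mul_zero] at ht
      obtain ⟨n, hn⟩ := (ht.eventually (gt_mem_nhds hr)).exists
      refine ⟨(S n : Set U) ∪ x '' (Iic n), (S n).finite_toSet.union ((finite_Iic n).image x), ?_⟩
      rintro _ ⟨N, rfl⟩
      rw [mem_iUnion₂]
      by_cases hN : n < N
      · obtain ⟨s, hs, hd⟩ := hx N n hN
        exact ⟨s, Or.inl hs, hd.trans hn⟩
      · exact ⟨x N, Or.inr ⟨N, not_lt.1 hN, rfl⟩, Metric.mem_ball_self hr⟩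
    have hcomp : IsCompact (closure (range x)) :=
      htb.closure.isCompact_of_isClosed isClosed_closure
    obtain ⟨z, -, φ, hφ, hz⟩ := hcomp.tendsto_subseq (fun n => subset_closure (mem_range_self n))
    have hxy0 : Tendsto (fun n => dist (x (φ n)) (y (φ n))) atTop (𝓝 0) :=
      squeeze_zero (fun _ => dist_nonneg) (fun n => (hxy (φ n)).le)
        (tendsto_one_div_add_atTop_nhds_zero_nat.comp hφ.tendsto_atTop)
    have hy : Tendsto (fun n => y (φ n)) atTop (𝓝 z) :=
      (tendsto_iff_of_dist hxy0).1 hz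
    have hlim := ((hF.tendsto z).comp hz).dist ((hF.tendsto z).comp hy)
    rw [dist_self] at hlim
    obtain ⟨n, hn⟩ := (hlim.eventually (gt_mem_nhds hε)).exists
    exact absurd (hFxy (φ n)) (not_le.2 hn)
  obtain ⟨N, hN⟩ := key
  refine ⟨1 / ((N:ℝ) + 1), by positivity, ?_, ?_⟩
  · rw [div_le_one (by positivity)]
    have : (0:ℝ) ≤ N := by positivity
    linarith
  have hU : ∀ M : ℕ, UD {t | ∃ n < M, ∀ s ∈ S n, ε * (1 / 2) ^ (n + 1) ≤ dist (f t) s}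
      (ε * (1 - (1 / 2) ^ M)) := by
    intro M
    induction M with
    | zero => exact ⟨1, one_pos, fun l _ ξ => by simp⟩
    | succ M ih =>
      have h0 : (0:ℝ) ≤ ε * (1 - (1 / 2) ^ M) :=
        mul_nonneg hε.le (sub_nonneg.2 (pow_le_one₀ (by norm_num) (by norm_num)))
      refine ud_mono ?_ (le_of_eq ?_) (ud_union h0 (hη M).le ih (hS M))
      · rintro t ⟨n, hn, h⟩
        rcases Nat.lt_succ_iff_lt_or_eq.1 hn with h' | rfl
        · exact Or.inl ⟨n, h', h⟩
        · exact Or.inr h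
      · ring
  refine ud_mono ?_ ?_ (hU N)
  · rintro t ⟨y, hy, hFy⟩
    by_contra hcon
    simp only [mem_ofPred_eq] at hcon
    push Not at hcon
    exact absurd (hN _ _ hcon hy) (not_lt.2 hFy)
  · have : (0:ℝ) < (1/2) ^ N := by positivity
    nlinarith

end WAPProof

open Set WAPProof

theorem stmt12 {U V : Type*} [MetricSpace U] [CompleteSpace U]
    [MetricSpace V] [CompleteSpace V]
    (F : U → V) (hF : Continuous F) (f : ℝ → U) (hf : WAP f) :
    WAP (fun t => F (f t)) := by
  refine ⟨hF.comp_aestronglyMeasurable hf.1, fun ε₀ hε₀ => ?_⟩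
  obtain ⟨ε, hε, rfl⟩ : ∃ ε > 0, ε₀ = 4 * ε := ⟨ε₀ / 4, by positivity, by ring⟩
  obtain ⟨δ, hδ, hδ1, l0, hl0, hB⟩ := osc hF hf hε
  obtain ⟨l1, hl1, a, ha, hT⟩ := hf.2 (ε * δ) (by positivity)
  obtain ⟨k, hk⟩ := exists_nat_ge (l0 / l1)
  rw [div_le_iff₀ hl1] at hk
  have hl : 0 < k * l1 := hl0.trans_le hk
  set l := k * l1 with hldef
  refine ⟨l, hl, a, ha, fun ξ => ?_⟩
  obtain ⟨τ, hτ, h1, h2⟩ := hT ξ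
  refine ⟨τ, ?_, h1, h2⟩
  have hmF := aesm_D (hF.comp_aestronglyMeasurable hf.1) τ
  refine lt_of_le_of_lt (to_sup (c := 3 * ε) hmF (D_nonneg (fun t => F (f t)) τ)
    (fun t => min_le_left _ _) hl (by positivity) fun x => ?_) (by linarith)
  have hD : ∫⁻ t in Ioc x (x + l), ENNReal.ofReal (min 1 (dist (f t) (f (t + τ))))
      ≤ ENNReal.ofReal (ε * δ * l) := by
    have := chain (volume.withDensity fun t => ENNReal.ofReal (min 1 (dist (f t) (f (t + τ)))))
      hl1 (c := ε * δ) (by positivity) (fun ξ => by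
        rw [withDensity_apply _ measurableSet_Ioc]
        exact sup_to (aesm_D hf.1 τ) (D_nonneg f τ) (fun t => min_le_left _ _) hl1 hτ ξ) k x
    rwa [withDensity_apply _ measurableSet_Ioc] at this
  have hM := markov (aesm_D hf.1 τ) (c := ε * l) hδ
    (hD.trans (ENNReal.ofReal_le_ofReal (by linarith)))
  have hBx := hB l hk x
  set B := {t | ∃ y, dist (f t) y < δ ∧ ε ≤ dist (F (f t)) (F y)}
  set C := {t | δ ≤ min 1 (dist (f t) (f (t + τ)))}
  set E := toMeasurable (volume.restrict (Ioc x (x + l))) (B ∪ C) with hE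
  have hEm : MeasurableSet E := measurableSet_toMeasurable _ _
  have hEv : volume.restrict (Ioc x (x + l)) E ≤ ENNReal.ofReal (2 * ε * l) := by
    rw [hE, measure_toMeasurable, Measure.restrict_apply' measurableSet_Ioc,
      union_inter_distrib_right]
    refine (measure_union_le _ _).trans ((add_le_add hBx hM).trans ?_)
    rw [← ENNReal.ofReal_add (by positivity) (by positivity)]
    exact ENNReal.ofReal_le_ofReal (by linarith)
  calc ∫⁻ t in Ioc x (x + l), ENNReal.ofReal (min 1 (dist (F (f t)) (F (f (t + τ)))))
      ≤ ∫⁻ t in Ioc x (x + l), (ENNReal.ofReal ε + E.indicator 1 t) := by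
        refine lintegral_mono fun t => ?_
        by_cases ht : t ∈ E
        · simp only [indicator_of_mem ht, Pi.one_apply]
          refine le_trans ?_ le_add_self
          rw [ENNReal.ofReal_le_one]
          exact min_le_left _ _
        · refine le_trans (ENNReal.ofReal_le_ofReal ?_) le_self_add
          have ht' : t ∉ B ∪ C := fun h => ht (subset_toMeasurable _ _ h)
          have hb : t ∉ B := fun h => ht' (Or.inl h)
          have hc : t ∉ C := fun h => ht' (Or.inr h)
          refine (min_le_right _ _).trans ?_
          by_contra! hcon
          refine hb ⟨f (t + τ), ?_, hcon.le⟩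
          by_contra! h3
          exact hc (le_min hδ1 h3)
    _ = ENNReal.ofReal (ε * l) + volume.restrict (Ioc x (x + l)) E := by
        rw [lintegral_add_left measurable_const, lintegral_indicator_one hEm]
        simp [ENNReal.ofReal_mul hε.le]
    _ ≤ ENNReal.ofReal (ε * l) + ENNReal.ofReal (2 * ε * l) := by gcongr
    _ = ENNReal.ofReal (3 * ε * l) := by
        rw [← ENNReal.ofReal_add (by positivity) (by positivity)]
        congr 1; ring
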